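/- For all x in [0,1], all positive integers n, 0<q<1, and 0 ≤ α ≤ β, the q-Durrmeyer–Stancu operator satisfies D_{n,q}^{α,β}(1;x) = 1 and D_{n,q}^{α,β}(t;x) = ([n]_q + α[n+2]_q + q x [n]_q²)/([n+2]_q ([n]_q + β)). -/

import Mathlib

open Finset Filter Topology

/-- The q-integer `[n]_q = 1 + q + ⋯ + q^(n-1)`. -/
noncomputable def qInt (q : ℝ) (n : ℕ) : ℝ := ∑ i ∈ Finset.range n, q ^ i

/-- The q-factorial `[n]_q!`. -/
noncomputable def qFact (q : ℝ) (n : ℕ) : ℝ := ∏ i ∈ Finset.range n, qInt q (i + 1)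

/-- The q-binomial coefficient. -/
noncomputable def qBinom (q : ℝ) (n k : ℕ) : ℝ := qFact q n / (qFact q k * qFact q (n - k))

/-- `(1 - x)_q^n = ∏_{j=0}^{n-1} (1 - q^j x)`. -/
noncomputable def qOneSubPow (q x : ℝ) (n : ℕ) : ℝ := ∏ j ∈ Finset.range n, (1 - q ^ j * x)

/-- The q-Bernstein basis `p_{nk}(q;x)`. -/
noncomputable def qBern (q : ℝ) (n k : ℕ) (x : ℝ) : ℝ :=
  qBinom q n k * x ^ k * qOneSubPow q x (n - k)

/-- The Jackson q-integral on `[0,1]`. -/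
noncomputable def qIntegral (q : ℝ) (g : ℝ → ℝ) : ℝ := (1 - q) * ∑' j : ℕ, q ^ j * g (q ^ j)

/-- The q-Durrmeyer operator `D_{n,q}(f;x)`. -/
noncomputable def qDurrmeyer (q : ℝ) (n : ℕ) (f : ℝ → ℝ) (x : ℝ) : ℝ :=
  qInt q (n + 1) * ∑ k ∈ Finset.range (n + 1),
    q ^ (-(k : ℤ)) * qBern q n k x * qIntegral q (fun t => f t * qBern q n k (q * t))

/-- The q-Durrmeyer–Stancu operator `D_{n,q}^{α,β}(f;x)`. -/
noncomputable def qDurrmeyerStancu (q : ℝ) (n : ℕ) (α β : ℝ) (f : ℝ → ℝ) (x : ℝ) : ℝ :=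
  qDurrmeyer q n (fun t => f ((qInt q n * t + α) / (qInt q n + β))) x

/-- The q-derivative `D_q f(x) = (f(qx) - f(x)) / ((q-1)x)`. -/
noncomputable def qDeriv (q : ℝ) (f : ℝ → ℝ) (x : ℝ) : ℝ := (f (q * x) - f x) / ((q - 1) * x)

/-- The q-power `(t - x)_q^m = ∏_{j=0}^{m-1} (t - q^j x)`, as a function of `t`. -/
noncomputable def qCentral (q x : ℝ) (m : ℕ) (t : ℝ) : ℝ := ∏ j ∈ Finset.range m, (t - q ^ j * x)

theorem qInt_succ' (q : ℝ) (n : ℕ) : qInt q (n + 1) = q * qInt q n + 1 := by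
  simp [qInt, Finset.sum_range_succ', Finset.mul_sum, pow_succ']

theorem qInt_add (q : ℝ) (m n : ℕ) : qInt q (m + n) = qInt q m + q ^ m * qInt q n := by
  simp [qInt, Finset.sum_range_add, Finset.mul_sum, pow_add]

theorem qInt_pos {q : ℝ} (hq : 0 < q) {n : ℕ} (hn : 0 < n) : 0 < qInt q n :=
  Finset.sum_pos (fun _ _ => pow_pos hq _) (by simpa using hn.ne')

theorem qFact_zero (q : ℝ) : qFact q 0 = 1 := by simp [qFact]

theorem qFact_succ (q : ℝ) (n : ℕ) : qFact q (n + 1) = qFact q n * qInt q (n + 1) :=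
  Finset.prod_range_succ _ _

theorem qFact_pos {q : ℝ} (hq : 0 < q) (n : ℕ) : 0 < qFact q n :=
  Finset.prod_pos fun _ _ => qInt_pos hq (Nat.succ_pos _)

theorem qOneSubPow_succ (q x : ℝ) (n : ℕ) :
    qOneSubPow q x (n + 1) = qOneSubPow q x n * (1 - q ^ n * x) :=
  Finset.prod_range_succ _ _

/-- The terms of the q-beta integral of `t ^ m * (1 - q t)_q^r`. -/
theorem hasSum_qBeta {q : ℝ} (hq0 : 0 < q) (hq1 : q < 1) (m r : ℕ) :
    HasSum (fun j : ℕ => (1 - q) * (q ^ j * ((q ^ j) ^ m * qOneSubPow q (q * q ^ j) r)))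
      (qFact q m * qFact q r / qFact q (m + r + 1)) := by
  induction r generalizing m with
  | zero =>
    have hlt : q ^ (m + 1) < 1 := pow_lt_one₀ hq0.le hq1 (Nat.succ_ne_zero m)
    have hgeom : qInt q (m + 1) * (1 - q) = 1 - q ^ (m + 1) := geom_sum_mul_neg q (m + 1)
    have hq : 1 - q ^ (m + 1) ≠ 0 := by linarith
    have hI := (qInt_pos hq0 (Nat.succ_pos m)).ne'
    have hF := (qFact_pos hq0 m).ne'
    convert (hasSum_geometric_of_lt_one (pow_pos hq0 (m + 1)).le hlt).mul_left (1 - q) using 1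
    · rfl
    · ext j
      simp only [qOneSubPow, Finset.prod_range_zero]
      ring
    · rw [add_zero, qFact_succ, qFact_zero, mul_one, ← div_eq_mul_inv, div_eq_div_iff
        (mul_ne_zero hF hI) hq, ← hgeom]
      ring
  | succ r ih =>
    convert (ih m).sub ((ih (m + 1)).mul_left (q ^ (r + 1))) using 1
    · rfl
    · ext j
      rw [qOneSubPow_succ]
      ring
    · have hsplit : qInt q (m + r + 1 + 1) = qInt q (r + 1) + q ^ (r + 1) * qInt q (m + 1) := by
        rw [← qInt_add]
        congr 1
        ring
      have hI := (qInt_pos hq0 (Nat.succ_pos (m + r + 1))).ne'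
      have hF := (qFact_pos hq0 (m + r + 1)).ne'
      rw [show m + (r + 1) + 1 = m + r + 1 + 1 by ring, show m + 1 + r + 1 = m + r + 1 + 1 by ring,
        qFact_succ q (m + r + 1), qFact_succ q r, qFact_succ q m]
      field_simp
      rw [hsplit]
      ring

theorem qBern_succ_zero {q : ℝ} (hq : 0 < q) (n : ℕ) (x : ℝ) :
    qBern q (n + 1) 0 x = qBern q n 0 x * (1 - q ^ n * x) := by
  have h := fun m => (qFact_pos hq m).ne'
  simp only [qBern, qBinom, Nat.sub_zero, qFact_zero, one_mul, div_self (h _), qOneSubPow_succ]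
  ring

theorem qBern_self {q : ℝ} (hq : 0 < q) (n : ℕ) (x : ℝ) : qBern q n n x = x ^ n := by
  simp [qBern, qBinom, qOneSubPow, qFact_zero, (qFact_pos hq n).ne']

theorem qBern_succ_succ {q : ℝ} (hq : 0 < q) {n k : ℕ} (hk : k < n) (x : ℝ) :
    qBern q (n + 1) (k + 1) x =
      qBern q n (k + 1) x * (1 - q ^ (n - (k + 1)) * x) + q ^ (n - k) * x * qBern q n k x := by
  obtain ⟨l, rfl⟩ := Nat.exists_eq_add_of_lt hk
  have hk' := (qFact_pos hq k).ne'
  have hl := (qFact_pos hq l).ne'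
  have hIk := (qInt_pos hq (Nat.succ_pos k)).ne'
  have hIl := (qInt_pos hq (Nat.succ_pos l)).ne'
  have hsplit : qInt q (k + l + 1 + 1) = qInt q (l + 1) + q ^ (l + 1) * qInt q (k + 1) := by
    rw [← qInt_add]
    congr 1
    ring
  simp only [qBern, qBinom, show k + l + 1 + 1 - (k + 1) = l + 1 by omega,
    show k + l + 1 - (k + 1) = l by omega, show k + l + 1 - k = l + 1 by omega,
    qFact_succ q k, qFact_succ q l, qFact_succ q (k + l + 1), qOneSubPow_succ, hsplit]
  field_simp
  ring

theorem sum_qBern {q : ℝ} (hq : 0 < q) (n : ℕ) (x : ℝ) :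
    ∑ k ∈ Finset.range (n + 1), qBern q n k x = 1 := by
  induction n with
  | zero => simp [qBern_self hq]
  | succ n ih =>
    have hA := Finset.sum_range_succ' (fun k => qBern q n k x * (1 - q ^ (n - k) * x)) n
    have hB := Finset.sum_range_succ (fun k => q ^ (n - k) * x * qBern q n k x) n
    have hAB : ∑ k ∈ Finset.range (n + 1), qBern q n k x =
        ∑ k ∈ Finset.range (n + 1), qBern q n k x * (1 - q ^ (n - k) * x) +
          ∑ k ∈ Finset.range (n + 1), q ^ (n - k) * x * qBern q n k x := by
      rw [← Finset.sum_add_distrib]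
      exact Finset.sum_congr rfl fun k _ => by ring
    refine Eq.trans ?_ (hAB.symm.trans ih)
    rw [hA, hB, Finset.sum_range_succ, Finset.sum_range_succ', Finset.sum_congr rfl fun k hk =>
      qBern_succ_succ hq (Finset.mem_range.1 hk) x, Finset.sum_add_distrib, qBern_self hq,
      qBern_succ_zero hq, qBern_self hq]
    simp only [Nat.sub_self, Nat.sub_zero]
    ring

theorem qInt_mul_qBern_succ {q : ℝ} (hq : 0 < q) (n k : ℕ) (x : ℝ) :
    qInt q (k + 1) * qBern q (n + 1) (k + 1) x = qInt q (n + 1) * x * qBern q n k x := by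
  have hk := (qFact_pos hq k).ne'
  have hl := (qFact_pos hq (n - k)).ne'
  have hIk := (qInt_pos hq (Nat.succ_pos k)).ne'
  simp only [qBern, qBinom, Nat.add_sub_add_right, qFact_succ]
  field_simp
  ring

theorem sum_qInt_mul_qBern {q : ℝ} (hq : 0 < q) (n : ℕ) (x : ℝ) :
    ∑ k ∈ Finset.range (n + 1), qInt q k * qBern q n k x = qInt q n * x := by
  cases n with
  | zero => simp [qInt]
  | succ n =>
    rw [Finset.sum_range_succ', Finset.sum_congr rfl fun k _ => qInt_mul_qBern_succ hq n k x,
      ← Finset.mul_sum, sum_qBern hq]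
    simp [qInt]

theorem qIntegral_affine_mul_qBern {q : ℝ} (hq0 : 0 < q) (hq1 : q < 1) {n k : ℕ} (hk : k ≤ n)
    (a b : ℝ) :
    qIntegral q (fun t => (a * t + b) * qBern q n k (q * t)) =
      q ^ k / qInt q (n + 1) * (a * (qInt q (k + 1) / qInt q (n + 2)) + b) := by
  obtain ⟨l, rfl⟩ := Nat.exists_eq_add_of_le hk
  have hsum := (((hasSum_qBeta hq0 hq1 (k + 1) l).mul_left a).add
    ((hasSum_qBeta hq0 hq1 k l).mul_left b)).mul_left (qBinom q (k + l) k * q ^ k)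
  rw [qIntegral, ← tsum_mul_left]
  refine (HasSum.tsum_eq (a := _) ?_)
  convert hsum using 1
  · rfl
  · ext j
    simp only [qBern, Nat.add_sub_cancel_left]
    ring
  · have hFk := (qFact_pos hq0 k).ne'
    have hFl := (qFact_pos hq0 l).ne'
    have hF := (qFact_pos hq0 (k + l)).ne'
    have hI := (qInt_pos hq0 (Nat.succ_pos (k + l))).ne'
    have hI' := (qInt_pos hq0 (Nat.succ_pos (k + l + 1))).ne'
    rw [show k + 1 + l + 1 = k + l + 1 + 1 by ring]
    simp only [qBinom, Nat.add_sub_cancel_left, qFact_succ]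
    field_simp

theorem qDurrmeyer_affine {q : ℝ} (hq0 : 0 < q) (hq1 : q < 1) (n : ℕ) (a b x : ℝ) :
    qDurrmeyer q n (fun t => a * t + b) x =
      a * ((1 + q * x * qInt q n) / qInt q (n + 2)) + b := by
  have hI := (qInt_pos hq0 (Nat.succ_pos n)).ne'
  have hterm : ∀ k ∈ Finset.range (n + 1),
      q ^ (-(k : ℤ)) * qBern q n k x *
        qIntegral q (fun t => (a * t + b) * qBern q n k (q * t)) =
      (qInt q (n + 1))⁻¹ * (a * q / qInt q (n + 2) * (qInt q k * qBern q n k x) +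
        (a / qInt q (n + 2) + b) * qBern q n k x) := by
    intro k hk
    have hqk := (pow_pos hq0 k).ne'
    rw [qIntegral_affine_mul_qBern hq0 hq1 (Nat.lt_succ_iff.1 (Finset.mem_range.1 hk)),
      qInt_succ' q k, zpow_neg, zpow_natCast]
    field_simp
    ring
  rw [qDurrmeyer, Finset.sum_congr rfl hterm, ← Finset.mul_sum, Finset.sum_add_distrib,
    ← Finset.mul_sum, ← Finset.mul_sum, sum_qBern hq0, sum_qInt_mul_qBern hq0,
    mul_inv_cancel_left₀ hI]
  ring

/-- Zeroth and first moments of the q-Durrmeyer–Stancu operator. -/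
theorem qDurrmeyerStancu_first_moments (q x α β : ℝ) (hq0 : 0 < q) (hq1 : q < 1)
    (hα : 0 ≤ α) (hαβ : α ≤ β) (n : ℕ) (hn : 0 < n) (hx : x ∈ Set.Icc (0 : ℝ) 1) :
    qDurrmeyerStancu q n α β (fun _ => 1) x = 1 ∧
    qDurrmeyerStancu q n α β (fun t => t) x =
      (qInt q n + α * qInt q (n + 2) + q * x * qInt q n ^ 2) /
        (qInt q (n + 2) * (qInt q n + β)) := by
  have hI := qInt_pos hq0 hn
  have hI' := (qInt_pos hq0 (Nat.succ_pos (n + 1))).ne'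
  have hβ : qInt q n + β ≠ 0 := by linarith
  constructor
  · simpa [qDurrmeyerStancu] using qDurrmeyer_affine hq0 hq1 n 0 1 x
  · have haffine : (fun t : ℝ => (qInt q n * t + α) / (qInt q n + β)) =
        fun t => qInt q n / (qInt q n + β) * t + α / (qInt q n + β) := by
      ext t
      ring
    rw [qDurrmeyerStancu, haffine, qDurrmeyer_affine hq0 hq1]
    field_simp
    ring
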